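/- arXiv:2409.12067 — 3 statements merged into one kernel-verified Lean document; each statement's English description precedes it below -/
import Mathlib

section
/- Let D be an n×n real positive definite diagonal matrix and F an n×s real matrix, and set Σ = F Fᵀ + D. Then the s×s matrix I − Fᵀ Σ⁻¹ F is positive definite. -/
open Matrix

/-- For `D` positive definite diagonal and `Σ = F Fᵀ + D`, the matrix `I − Fᵀ Σ⁻¹ F`
is positive definite. -/
theorem one_sub_conj_posDef {n s : Type*} [Fintype n] [Fintype s] [DecidableEq n] [DecidableEq s]
    (D : Matrix n n ℝ) (hD : D.PosDef) (hDiag : D.IsDiag) (F : Matrix n s ℝ) :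
    (1 - Fᵀ * (F * Fᵀ + D)⁻¹ * F).PosDef := by
  have hS : (F * Fᵀ + D).PosDef := by
    simpa using PosDef.posSemidef_add (posSemidef_self_mul_conjTranspose F) hD
  have hM : (1 + Fᵀ * D⁻¹ * F).PosDef := by
    simpa using PosDef.one.add_posSemidef (hD.inv.posSemidef.conjTranspose_mul_mul_same F)
  have hDD : D⁻¹⁻¹ = D := nonsing_inv_nonsing_inv D ((isUnit_iff_isUnit_det D).1 hD.isUnit)
  have woodbury := add_mul_mul_inv_eq_sub (1 : Matrix s s ℝ) Fᵀ D⁻¹ F isUnit_one hD.inv.isUnit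
    (by simpa [hDD, add_comm] using hS.isUnit)
  simp only [hDD, inv_one, Matrix.one_mul, Matrix.mul_one, add_comm D] at woodbury
  exact woodbury ▸ hM.inv
end

section
/- Let D⁰ be an n×n real positive definite matrix, F⁰ an n×s real matrix, Σ⁰ = F⁰ (F⁰)ᵀ + D⁰, Y an N×n real matrix, and let N ≥ 1. Then the matrix W = N·(I − (F⁰)ᵀ (Σ⁰)⁻¹ F⁰) + (F⁰)ᵀ (Σ⁰)⁻¹ Yᵀ Y (Σ⁰)⁻¹ F⁰ is positive definite. -/
open Matrix

/-- The push-through form of the Woodbury identity shows that `I - Fᵀ (F Fᵀ + D)⁻¹ F` is the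
inverse of the positive definite matrix `I + Fᵀ D⁻¹ F`. -/
theorem posDef_one_sub_transpose_mul_inv_mul {n s : Type*} [Fintype n] [Fintype s]
    [DecidableEq n] [DecidableEq s] {D : Matrix n n ℝ} (hD : D.PosDef) (F : Matrix n s ℝ) :
    (1 - Fᵀ * (F * Fᵀ + D)⁻¹ * F).PosDef := by
  have hS : (F * Fᵀ + D).PosDef := by
    simpa using PosDef.posSemidef_add (posSemidef_self_mul_conjTranspose F) hD
  have hP : (1 + Fᵀ * D⁻¹ * F).PosDef := by
    simpa using PosDef.add_posSemidef PosDef.one (hD.inv.posSemidef.conjTranspose_mul_mul_same F)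
  have hDD : D⁻¹⁻¹ = D := nonsing_inv_nonsing_inv D ((isUnit_iff_isUnit_det D).1 hD.isUnit)
  have hW := add_mul_mul_inv_eq_sub 1 Fᵀ D⁻¹ F isUnit_one hD.inv.isUnit
    (by simpa [hDD, add_comm] using hS.isUnit)
  simp only [hDD, inv_one, Matrix.mul_one, Matrix.one_mul, add_comm D] at hW
  exact hW ▸ hP.inv

/-- The matrix `W = N (I − (F⁰)ᵀ (Σ⁰)⁻¹ F⁰) + (F⁰)ᵀ (Σ⁰)⁻¹ Yᵀ Y (Σ⁰)⁻¹ F⁰` is positive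
definite, where `Σ⁰ = F⁰ (F⁰)ᵀ + D⁰` with `D⁰` positive definite, `Y` is `N × n`, and `N ≥ 1`. -/
theorem W_posDef {n s : Type*} [Fintype n] [Fintype s] [DecidableEq n] [DecidableEq s]
    (N : ℕ) (hN : 1 ≤ N)
    (D0 : Matrix n n ℝ) (hD0 : D0.PosDef) (F0 : Matrix n s ℝ) (Y : Matrix (Fin N) n ℝ)
    (S0 : Matrix n n ℝ) (hS0 : S0 = F0 * F0ᵀ + D0) :
    ((N : ℝ) • (1 - F0ᵀ * S0⁻¹ * F0) + F0ᵀ * S0⁻¹ * Yᵀ * Y * S0⁻¹ * F0).PosDef := by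
  have hNpos : (0 : ℝ) < N := by exact_mod_cast hN
  have hS : S0.PosDef := by
    simpa [hS0] using PosDef.posSemidef_add (posSemidef_self_mul_conjTranspose F0) hD0
  have hSinv : (S0⁻¹)ᵀ = S0⁻¹ := by simpa using hS.inv.isHermitian.eq
  refine PosDef.add_posSemidef ?_ ?_
  · subst hS0
    exact (posDef_one_sub_transpose_mul_inv_mul hD0 F0).smul hNpos
  · have h := posSemidef_conjTranspose_mul_self (Y * S0⁻¹ * F0)
    rw [conjTranspose_eq_transpose_of_trivial, transpose_mul, transpose_mul, hSinv] at h
    simpa only [Matrix.mul_assoc] using h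
end

section
/- Let D be an n×n real positive definite matrix, let L ≥ 2, and let F_l be an n×k_l real matrix for l = 1,…,L−1. Define Σ_{L+} = D and Σ_{l+} = F_l F_lᵀ + Σ_{(l+1)+} for l = L−1,…,1, and for each l define H_l = Σ_{(l+1)+}⁻¹ F_l S_l⁻¹, where S_l is the unique positive definite square root of I_{k_l} + F_lᵀ Σ_{(l+1)+}⁻¹ F_l. Then for every l = 1,…,L−1 one has Σ_{l+}⁻¹ = Σ_{(l+1)+}⁻¹ − H_l H_lᵀ, and consequently (F_1F_1ᵀ + ⋯ + F_{L−1}F_{L−1}ᵀ + D)⁻¹ = D⁻¹ − H_1H_1ᵀ − ⋯ − H_{L−1}H_{L−1}ᵀ. -/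
open Matrix

/-- Woodbury identity for a low rank update of a symmetric matrix, written with a symmetric square
root of the capacitance matrix. -/
theorem inv_add_mul_transpose_of_sqrt {m n : Type*} [Fintype m] [DecidableEq m] [Fintype n]
    [DecidableEq n] {R : Type*} [CommRing R] {A : Matrix m m R} {F : Matrix m n R}
    {S : Matrix n n R} (hA : IsUnit A) (hAs : A.IsSymm) (hS : IsUnit S) (hSs : S.IsSymm)
    (hSS : S * S = 1 + Fᵀ * A⁻¹ * F) :
    (A + F * Fᵀ)⁻¹ = A⁻¹ - A⁻¹ * F * S⁻¹ * (A⁻¹ * F * S⁻¹)ᵀ := by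
  have h := add_mul_mul_inv_eq_sub A F 1 Fᵀ hA isUnit_one
    (by rw [inv_one, ← hSS]; exact hS.mul hS)
  rw [inv_one, ← hSS, Matrix.mul_inv_rev, Matrix.mul_one] at h
  rw [h]
  simp only [transpose_mul, transpose_nonsing_inv, hAs.eq, hSs.eq, Matrix.mul_assoc]

/-- Recursive Sherman–Morrison–Woodbury for multilevel low rank matrices:
with `Σ_{l+} = D + ∑_{l' ≥ l} F_{l'} F_{l'}ᵀ` (here `St l`), `S_l` the unique positive
definite square root of `I + F_lᵀ Σ_{(l+1)+}⁻¹ F_l`, and `H_l = Σ_{(l+1)+}⁻¹ F_l S_l⁻¹`,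
one has `Σ_{l+}⁻¹ = Σ_{(l+1)+}⁻¹ − H_l H_lᵀ` for every level `l`, and hence
`Σ⁻¹ = D⁻¹ − ∑_l H_l H_lᵀ`.  Levels are indexed by `l = 0, …, L−2`, corresponding to the
paper's levels `1, …, L−1`. -/
theorem mlr_inverse {n : ℕ} (L : ℕ) (hL : 2 ≤ L) (k : ℕ → ℕ)
    (D : Matrix (Fin n) (Fin n) ℝ) (hD : D.PosDef)
    (F : (l : ℕ) → Matrix (Fin n) (Fin (k l)) ℝ)
    (St : ℕ → Matrix (Fin n) (Fin n) ℝ)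
    (hSt : ∀ l, St l = D + ∑ l' ∈ Finset.Ico l (L - 1), F l' * (F l')ᵀ)
    (S : (l : ℕ) → Matrix (Fin (k l)) (Fin (k l)) ℝ)
    (hSpos : ∀ l, (S l).PosDef)
    (hSS : ∀ l, S l * S l = 1 + (F l)ᵀ * (St (l + 1))⁻¹ * F l)
    (H : (l : ℕ) → Matrix (Fin n) (Fin (k l)) ℝ)
    (hH : ∀ l, H l = (St (l + 1))⁻¹ * F l * (S l)⁻¹) :
    (∀ l < L - 1, (St l)⁻¹ = (St (l + 1))⁻¹ - H l * (H l)ᵀ) ∧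
      (D + ∑ l ∈ Finset.range (L - 1), F l * (F l)ᵀ)⁻¹ =
        D⁻¹ - ∑ l ∈ Finset.range (L - 1), H l * (H l)ᵀ := by
  have hpos (l : ℕ) : (St l).PosDef := by
    rw [hSt]
    refine hD.add_posSemidef (posSemidef_sum _ fun i _ => ?_)
    simpa using posSemidef_self_mul_conjTranspose (F i)
  have hstep : ∀ l < L - 1, (St l)⁻¹ = (St (l + 1))⁻¹ - H l * (H l)ᵀ := by
    intro l hl
    have hrec : St l = St (l + 1) + F l * (F l)ᵀ := by
      rw [hSt, hSt, Finset.sum_eq_sum_Ico_succ_bot hl]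
      abel
    rw [hrec, hH]
    exact inv_add_mul_transpose_of_sqrt (hpos _).isUnit
      (by simpa [IsHermitian, IsSymm] using (hpos (l + 1)).isHermitian) (hSpos l).isUnit
      (by simpa [IsHermitian, IsSymm] using (hSpos l).isHermitian) (hSS l)
  refine ⟨hstep, ?_⟩
  have htop : St (L - 1) = D := by simp [hSt]
  have hbot : St 0 = D + ∑ l ∈ Finset.range (L - 1), F l * (F l)ᵀ := by
    rw [hSt, Finset.range_eq_Ico]
  have hsum : ∑ l ∈ Finset.range (L - 1), H l * (H l)ᵀ = (St (L - 1))⁻¹ - (St 0)⁻¹ := by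
    rw [← Finset.sum_range_sub fun l => (St l)⁻¹]
    refine Finset.sum_congr rfl fun l hl => ?_
    rw [hstep l (Finset.mem_range.mp hl), sub_sub_cancel]
  rw [← hbot, hsum, htop, sub_sub_cancel]
end
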